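/- For all x, y ∈ ℝ and all η, t > 0, one has ∫_ℝ |p_t(x,z) − p_t(y,z)|·e^{η|z|}·η|z| dz ≤ ( √2·|x−y| / √t ) · [ e^{η²t}·e^{η(|x|+|x−y|)}·η(|x|+|x−y|) + 2·e^{η²t}·( 2η²t + η·√(t/π) )·e^{η(|x|+|x−y|)} ]. -/

import Mathlib

open MeasureTheory Real

/-- The one-dimensional heat kernel `p_t(x,y) = (2πt)^{-1/2} exp(-(x-y)²/(2t))`. -/
noncomputable def heatKernel (t x y : ℝ) : ℝ :=
  (Real.sqrt (2 * Real.pi * t))⁻¹ * Real.exp (-(x - y) ^ 2 / (2 * t))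

lemma heatKernel_nonneg (t x y : ℝ) : 0 ≤ heatKernel t x y := by
  unfold heatKernel; positivity

lemma continuous_heatKernel (t : ℝ) : Continuous fun q : ℝ × ℝ ↦ heatKernel t q.1 q.2 := by
  unfold heatKernel; fun_prop

lemma heatKernel_eq_sub (t x y : ℝ) : heatKernel t x y = heatKernel t 0 (y - x) := by
  unfold heatKernel; congr 3; ring

lemma heatKernel_neg_neg (t x y : ℝ) : heatKernel t (-x) (-y) = heatKernel t x y := by
  unfold heatKernel; congr 3; ring

lemma heatKernel_zero_eq (t y : ℝ) :
    heatKernel t 0 y = (√(2 * π * t))⁻¹ * exp (-(1 / (2 * t)) * y ^ 2) := by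
  unfold heatKernel; congr 2; ring

lemma integrable_heatKernel_zero {t : ℝ} (ht : 0 < t) : Integrable (heatKernel t 0) := by
  simp_rw [funext (heatKernel_zero_eq t)]
  exact (integrable_exp_neg_mul_sq (by positivity)).const_mul _

lemma integral_heatKernel_zero {t : ℝ} (ht : 0 < t) : ∫ u, heatKernel t 0 u = 1 := by
  simp_rw [heatKernel_zero_eq, integral_const_mul, integral_gaussian]
  rw [show π / (1 / (2 * t)) = 2 * π * t by field_simp]
  exact inv_mul_cancel₀ (by positivity)

lemma integrable_heatKernel_zero_mul_id {t : ℝ} (ht : 0 < t) :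
    Integrable fun u ↦ heatKernel t 0 u * u := by
  simp_rw [heatKernel_zero_eq]
  convert (integrable_mul_exp_neg_mul_sq (b := 1 / (2 * t)) (by positivity)).const_mul
    (√(2 * π * t))⁻¹ using 2
  ring

lemma integral_heatKernel_zero_mul_id (t : ℝ) : ∫ u, heatKernel t 0 u * u = 0 := by
  have h := integral_neg_eq_self (fun u ↦ heatKernel t 0 u * u) volume
  have h' : ∀ u, heatKernel t 0 (-u) * -u = -(heatKernel t 0 u * u) := fun u ↦ by
    rw [← heatKernel_neg_neg t 0 u, neg_zero]; ring
  simp_rw [h', integral_neg] at h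
  linarith

lemma integrable_heatKernel_zero_mul_abs {t : ℝ} (ht : 0 < t) :
    Integrable fun u ↦ heatKernel t 0 u * |u| := by
  refine (integrable_heatKernel_zero_mul_id ht).norm.congr (ae_of_all _ fun u ↦ ?_)
  simp [abs_of_nonneg (heatKernel_nonneg t 0 u)]

lemma integral_heatKernel_zero_mul_abs {t : ℝ} (ht : 0 < t) :
    ∫ u, heatKernel t 0 u * |u| = √(2 * t / π) := by
  have h := integral_comp_abs (f := fun u ↦ heatKernel t 0 u * u)
  have h1 := integral_rpow_mul_exp_neg_mul_rpow (p := 2) (q := 1) (b := 1 / (2 * t))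
    (by norm_num) (by norm_num) (by positivity)
  have h2 : ∫ u in Set.Ioi (0 : ℝ), heatKernel t 0 u * u = (√(2 * π * t))⁻¹ * t := by
    have : ∀ u : ℝ, heatKernel t 0 u * u
        = (√(2 * π * t))⁻¹ * (u ^ (1 : ℝ) * exp (-(1 / (2 * t)) * u ^ (2 : ℝ))) := fun u ↦ by
      rw [heatKernel_zero_eq, rpow_one, rpow_two]; ring
    simp_rw [this, integral_const_mul, h1]
    rw [show (-(1 + 1) / 2 : ℝ) = -1 by norm_num, show ((1 + 1) / 2 : ℝ) = 1 by norm_num,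
      rpow_neg_one, Gamma_one]
    field_simp
  have h3 : ∀ u : ℝ, heatKernel t 0 |u| = heatKernel t 0 u := fun u ↦ by
    simp [heatKernel_zero_eq]
  simp_rw [h3, h2] at h
  rw [h, eq_comm, Real.sqrt_eq_iff_mul_self_eq (by positivity) (by positivity)]
  have : √(2 * π * t) ^ 2 = 2 * π * t := sq_sqrt (by positivity)
  have hp : 0 < √(2 * π * t) := by positivity
  generalize √(2 * π * t) = q at this hp
  field_simp
  rw [this]
  ring

/-- Exponential tilting of the heat kernel is a shift. -/
lemma heatKernel_zero_mul_exp {t : ℝ} (ht : 0 < t) (η u : ℝ) :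
    heatKernel t 0 u * exp (η * u) = exp (η ^ 2 * t / 2) * heatKernel t 0 (u - η * t) := by
  rw [heatKernel_zero_eq, heatKernel_zero_eq, mul_assoc, ← exp_add, mul_left_comm, ← exp_add]
  congr 2
  field_simp
  ring

lemma mul_exp_add_exp_neg_mono {v w : ℝ} (hv : 0 ≤ v) (hvw : v ≤ w) :
    v * (exp v + exp (-v)) ≤ w * (exp w + exp (-w)) := by
  have h : cosh v ≤ cosh w :=
    cosh_le_cosh.2 (by rwa [abs_of_nonneg hv, abs_of_nonneg (hv.trans hvw)])
  rw [cosh_eq, cosh_eq] at h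
  exact mul_le_mul hvw (by linarith) (by positivity) (hv.trans hvw)

lemma exp_abs_mul_abs_add_le_of_nonneg {a u : ℝ} (ha : 0 ≤ a) (hu : 0 ≤ u) :
    exp |a + u| * |a + u| + exp |a - u| * |a - u| ≤
      exp u * ((a + u) * exp a + |u|) + exp (-u) * ((a - u) * exp a + |u|) := by
  rw [abs_of_nonneg (add_nonneg ha hu), abs_of_nonneg hu]
  have h1 : exp (a + u) = exp u * exp a := by rw [← exp_add, add_comm]
  have h2 : exp (a - u) = exp (-u) * exp a := by rw [← exp_add]; ring_nf
  rcases le_total u a with h | h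
  · rw [abs_of_nonneg (sub_nonneg.2 h), h1, h2]
    nlinarith [mul_nonneg (exp_pos u).le hu, mul_nonneg (exp_pos (-u)).le hu]
  · rw [abs_of_nonpos (sub_nonpos.2 h), neg_sub, h1]
    have := mul_exp_add_exp_neg_mono (sub_nonneg.2 h) (by linarith : u - a ≤ u)
    rw [neg_sub, h2] at this
    nlinarith

lemma exp_abs_mul_abs_add_le {a : ℝ} (ha : 0 ≤ a) (u : ℝ) :
    exp |a + u| * |a + u| + exp |a - u| * |a - u| ≤
      exp u * ((a + u) * exp a + |u|) + exp (-u) * ((a - u) * exp a + |u|) := by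
  rcases le_total 0 u with h | h
  · exact exp_abs_mul_abs_add_le_of_nonneg ha h
  · have := exp_abs_mul_abs_add_le_of_nonneg ha (neg_nonneg.2 h)
    simp only [abs_neg, neg_neg, sub_neg_eq_add, ← sub_eq_add_neg] at this
    linarith

lemma heatKernel_increment_le {t : ℝ} (ht : 0 < t) (x y z : ℝ) :
    |heatKernel t x z - heatKernel t y z| ≤
      ∫ a in Set.uIoc x y, √2 / √t * heatKernel (2 * t) a z := by
  have hd : ∀ a : ℝ, HasDerivAt (fun a ↦ heatKernel t a z)
      (-((a - z) / t) * heatKernel t a z) a := fun a ↦ by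
    have h := ((((hasDerivAt_id a).sub_const z).pow 2).neg.div_const (2 * t)).exp.const_mul
      (√(2 * π * t))⁻¹
    convert! h using 1
    unfold heatKernel
    simp
    field_simp
  have hc : Continuous fun a ↦ -((a - z) / t) * heatKernel t a z := by
    unfold heatKernel; fun_prop
  have hc' : Continuous fun a ↦ √2 / √t * heatKernel (2 * t) a z := by
    unfold heatKernel; fun_prop
  have hftc := intervalIntegral.integral_eq_sub_of_hasDerivAt (fun a _ ↦ hd a)
    (hc.intervalIntegrable x y)
  rw [abs_sub_comm, ← hftc]
  rw [← norm_eq_abs]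
  refine le_trans intervalIntegral.norm_integral_le_integral_norm_uIoc ?_
  refine setIntegral_mono (intervalIntegrable_iff.1 (hc.norm.intervalIntegrable x y))
    (intervalIntegrable_iff.1 (hc'.intervalIntegrable x y)) fun a ↦ ?_
  set w := a - z with hw
  set r := |w| / √t with hr
  have hst : √t ^ 2 = t := sq_sqrt ht.le
  have hr2 : w ^ 2 = r ^ 2 * t := by
    rw [hr, div_pow, hst, sq_abs]; field_simp
  have hr0 : r ≤ exp (r ^ 2 / 4) := by
    nlinarith [add_one_le_exp (r ^ 2 / 4), sq_nonneg (r - 2)]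
  have h4 : √(2 * π * (2 * t)) = √2 * √(2 * π * t) := by
    rw [← sqrt_mul (by norm_num)]; ring_nf
  have h5 : exp (-w ^ 2 / (2 * (2 * t))) = exp (r ^ 2 / 4) * exp (-w ^ 2 / (2 * t)) := by
    rw [← exp_add, hr2]; congr 1; field_simp; ring
  have h6 : |w| / t = r / √t := by
    rw [hr, div_div, ← sq, hst]
  rw [norm_mul, norm_neg, norm_eq_abs, abs_div, abs_of_pos ht, norm_eq_abs,
    abs_of_nonneg (heatKernel_nonneg _ _ _), h6]
  unfold heatKernel
  rw [← hw, h4, h5]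
  calc r / √t * ((√(2 * π * t))⁻¹ * exp (-w ^ 2 / (2 * t)))
      ≤ exp (r ^ 2 / 4) / √t * ((√(2 * π * t))⁻¹ * exp (-w ^ 2 / (2 * t))) := by gcongr
    _ = _ := by field_simp

lemma heatKernel_weighted_of_nonneg {t η a : ℝ} (ht : 0 < t) (hη : 0 < η) (ha : 0 ≤ a) :
    Integrable (fun z ↦ heatKernel (2 * t) a z * (exp (η * |z|) * (η * |z|))) ∧
    ∫ z, heatKernel (2 * t) a z * (exp (η * |z|) * (η * |z|)) ≤
      exp (η ^ 2 * t) * exp (η * a) * (η * a)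
        + 2 * exp (η ^ 2 * t) * (2 * η ^ 2 * t + η * √(t / π)) * exp (η * a) := by
  set p := heatKernel (2 * t) 0 with hp
  have hpc : Continuous p := by rw [hp]; unfold heatKernel; fun_prop
  have hp0 : ∀ u, 0 ≤ p u := heatKernel_nonneg _ _
  have ht2 : 0 < 2 * t := by positivity
  set E := exp (η ^ 2 * t) with hE
  set m := η * (2 * t) with hm
  have hm0 : 0 < m := by positivity
  have htilt : ∀ u, p u * exp (η * u) = E * p (u - m) := fun u ↦ by
    rw [hp, heatKernel_zero_mul_exp ht2, hE, show η ^ 2 * (2 * t) / 2 = η ^ 2 * t by ring]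
  have hpneg : ∀ u, p (-u) = p u := fun u ↦ by
    rw [hp, ← heatKernel_neg_neg _ 0 u, neg_zero]
  set D : ℝ → ℝ := fun w ↦ E * (exp (η * a) * (η * (a + m)) + η * m) * p w
    + E * exp (η * a) * η * (p w * w) + E * η * (p w * |w|) with hD
  have i0 := (integrable_heatKernel_zero ht2).const_mul
    (E * (exp (η * a) * (η * (a + m)) + η * m))
  have i1 := (integrable_heatKernel_zero_mul_id ht2).const_mul (E * exp (η * a) * η)
  have i2 := (integrable_heatKernel_zero_mul_abs ht2).const_mul (E * η)
  have hDi : Integrable D := (i0.add i1).add i2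
  have hs : √(2 * (2 * t) / π) = 2 * √(t / π) := by
    rw [show 2 * (2 * t) / π = 2 ^ 2 * (t / π) by ring, sqrt_mul (by norm_num),
      sqrt_sq (by norm_num)]
  have hDI : ∫ w, D w = E * (exp (η * a) * (η * (a + m)) + η * m) + E * η * (2 * √(t / π)) := by
    refine (integral_add (i0.add i1) i2).trans ?_
    rw [integral_add' i0 i1]
    simp_rw [integral_const_mul]
    rw [integral_heatKernel_zero ht2, integral_heatKernel_zero_mul_id,
      integral_heatKernel_zero_mul_abs ht2, hs]
    ring
  set C : ℝ → ℝ := fun u ↦ D (u - m) with hC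
  have hCi : Integrable C := hDi.comp_sub_right m
  have hCI : ∫ u, C u = ∫ w, D w := integral_sub_right_eq_self D m
  set F : ℝ → ℝ := fun u ↦ p u * (exp (η * |a + u|) * (η * |a + u|)) with hF
  have hF0 : ∀ u, 0 ≤ F u := fun u ↦ mul_nonneg (hp0 u) (by positivity)
  have hle : ∀ u, p u * (exp (η * u) * ((η * a + η * u) * exp (η * a) + η * |u|)) ≤ C u := by
    intro u
    have : |u| ≤ |u - m| + m := by
      simpa [abs_of_pos hm0] using abs_add_le (u - m) m
    calc p u * (exp (η * u) * ((η * a + η * u) * exp (η * a) + η * |u|))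
        = E * p (u - m) * ((η * a + η * u) * exp (η * a) + η * |u|) := by
          rw [← mul_assoc, htilt]
      _ ≤ E * p (u - m) * ((η * a + η * u) * exp (η * a) + η * (|u - m| + m)) := by
          have := hp0 (u - m)
          gcongr
      _ = C u := by simp only [hC, hD]; ring
  have hFC : ∀ u, F u + F (-u) ≤ C u + C (-u) := by
    intro u
    have h := mul_le_mul_of_nonneg_left
      (exp_abs_mul_abs_add_le (mul_nonneg hη.le ha) (η * u)) (hp0 u)
    have h1 := hle u
    have h2 := hle (-u)
    rw [hpneg, abs_neg] at h2
    rw [← mul_add, ← mul_sub] at h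
    simp only [abs_mul, abs_of_pos hη] at h
    simp only [hF, hpneg, ← sub_eq_add_neg]
    simp only [mul_neg, ← sub_eq_add_neg] at h2
    have h3 : η * (a + u) = η * a + η * u := by ring
    have h4 : η * (a - u) = η * a - η * u := by ring
    rw [h3, h4] at h
    linarith
  have hCs : Integrable fun u ↦ C u + C (-u) := hCi.add hCi.comp_neg
  have hFi : Integrable F := by
    refine hCs.mono' (by rw [hF]; fun_prop) (ae_of_all _ fun u ↦ ?_)
    rw [norm_eq_abs, abs_of_nonneg (hF0 u)]
    linarith [hFC u, hF0 (-u)]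
  have hFI : ∫ u, F u ≤ ∫ u, C u := by
    have h := integral_mono (hFi.add hFi.comp_neg) hCs hFC
    rw [integral_add' hFi hFi.comp_neg, integral_add hCi hCi.comp_neg, integral_neg_eq_self F,
      integral_neg_eq_self C] at h
    linarith
  have hshift : (fun z ↦ heatKernel (2 * t) a z * (exp (η * |z|) * (η * |z|)))
      = fun z ↦ F (z - a) := by
    ext z
    simp only [hF, hp, ← heatKernel_eq_sub, add_sub_cancel]
  rw [hshift, integral_sub_right_eq_self F]
  refine ⟨hFi.comp_sub_right a, hFI.trans ?_⟩
  rw [hCI, hDI]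
  have h1 : 1 ≤ exp (η * a) := one_le_exp (by positivity)
  have h2 : 0 ≤ E * (η * m + η * (2 * √(t / π))) := by positivity
  calc _ = E * exp (η * a) * (η * (a + m)) + E * (η * m + η * (2 * √(t / π))) * 1 := by ring
    _ ≤ E * exp (η * a) * (η * (a + m))
        + E * (η * m + η * (2 * √(t / π))) * exp (η * a) := by gcongr
    _ = _ := by rw [hm]; ring

lemma heatKernel_weighted {t η : ℝ} (ht : 0 < t) (hη : 0 < η) (a : ℝ) :
    Integrable (fun z ↦ heatKernel (2 * t) a z * (exp (η * |z|) * (η * |z|))) ∧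
    ∫ z, heatKernel (2 * t) a z * (exp (η * |z|) * (η * |z|)) ≤
      exp (η ^ 2 * t) * exp (η * |a|) * (η * |a|)
        + 2 * exp (η ^ 2 * t) * (2 * η ^ 2 * t + η * √(t / π)) * exp (η * |a|) := by
  rcases le_total 0 a with h | h
  · rw [abs_of_nonneg h]
    exact heatKernel_weighted_of_nonneg ht hη h
  · rw [abs_of_nonpos h]
    have hr : (fun z ↦ heatKernel (2 * t) a z * (exp (η * |z|) * (η * |z|))) = fun z ↦
        (fun z ↦ heatKernel (2 * t) (-a) z * (exp (η * |z|) * (η * |z|))) (-z) := by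
      ext z
      simp only [heatKernel_neg_neg, abs_neg]
    obtain ⟨h1, h2⟩ := heatKernel_weighted_of_nonneg ht hη (neg_nonneg.2 h)
    rw [hr]
    exact ⟨h1.comp_neg, (integral_neg_eq_self _ volume).trans_le h2⟩

/-- Weighted spatial-increment bound for the heat kernel with a linear weight
(Lemma 3.4 (iv)). -/
theorem heatKernel_space_increment_weighted_linear (x y η t : ℝ)
    (hη : 0 < η) (ht : 0 < t) :
    (∫ z : ℝ, |heatKernel t x z - heatKernel t y z| * Real.exp (η * |z|) * (η * |z|)) ≤
      (Real.sqrt 2 * |x - y| / Real.sqrt t) *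
        (Real.exp (η ^ 2 * t) * Real.exp (η * (|x| + |x - y|)) * (η * (|x| + |x - y|))
          + 2 * Real.exp (η ^ 2 * t) * (2 * η ^ 2 * t + η * Real.sqrt (t / Real.pi))
              * Real.exp (η * (|x| + |x - y|))) := by
  set G : ℝ → ℝ := fun b ↦ exp (η ^ 2 * t) * exp (η * b) * (η * b)
    + 2 * exp (η ^ 2 * t) * (2 * η ^ 2 * t + η * √(t / π)) * exp (η * b) with hG
  have hGnn : ∀ b, 0 ≤ b → 0 ≤ G b := fun b hb ↦ by simp only [hG]; positivity
  have hGmono : ∀ b c, 0 ≤ b → b ≤ c → G b ≤ G c := fun b c hb hbc ↦ by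
    simp only [hG]; gcongr
  set f : ℝ → ℝ := fun z ↦ exp (η * |z|) * (η * |z|) with hf
  have hf0 : ∀ z, 0 ≤ f z := fun z ↦ by positivity
  have hfc : Continuous f := by fun_prop
  set k : ℝ → ℝ → ℝ := fun a z ↦ √2 / √t * (heatKernel (2 * t) a z * f z) with hk
  have hkc : Continuous fun q : ℝ × ℝ ↦ k q.1 q.2 :=
    ((continuous_heatKernel (2 * t)).mul (hfc.comp continuous_snd)).const_mul _
  have hk0 : ∀ a z, 0 ≤ k a z := fun a z ↦
    mul_nonneg (by positivity) (mul_nonneg (heatKernel_nonneg _ _ _) (hf0 z))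
  have hka : ∀ a ∈ Set.uIoc x y,
      ∫⁻ z, ENNReal.ofReal (k a z) ≤ ENNReal.ofReal (√2 / √t * G (|x| + |x - y|)) := by
    intro a ha
    obtain ⟨h1, h2⟩ := heatKernel_weighted ht hη a
    rw [← ofReal_integral_eq_lintegral_ofReal (h1.const_mul _) (ae_of_all _ (hk0 a))]
    have ha' : |a| ≤ |x| + |x - y| := by
      have h3 := Set.abs_sub_left_of_mem_uIcc (Set.uIoc_subset_uIcc ha)
      have h4 := abs_add_le x (a - x)
      rw [add_sub_cancel] at h4
      rw [abs_sub_comm y x] at h3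
      linarith
    refine ENNReal.ofReal_le_ofReal ?_
    simp only [integral_const_mul]
    gcongr
    exact h2.trans (hGmono _ _ (abs_nonneg a) ha')
  have hpt : ∀ z, ENNReal.ofReal
      (|heatKernel t x z - heatKernel t y z| * exp (η * |z|) * (η * |z|)) ≤
      ∫⁻ a in Set.uIoc x y, ENNReal.ofReal (k a z) := by
    intro z
    have hi : IntegrableOn (fun a ↦ k a z) (Set.uIoc x y) :=
      intervalIntegrable_iff.1
        ((hkc.comp (by fun_prop : Continuous fun a : ℝ ↦ (a, z))).intervalIntegrable x y)
    rw [← ofReal_integral_eq_lintegral_ofReal hi (ae_of_all _ fun a ↦ hk0 a z)]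
    refine ENNReal.ofReal_le_ofReal ?_
    simp only [hk, ← mul_assoc (√2 / √t), integral_mul_const]
    rw [mul_assoc]
    exact mul_le_mul_of_nonneg_right (heatKernel_increment_le ht x y z) (hf0 z)
  rw [integral_eq_lintegral_of_nonneg_ae (ae_of_all _ fun z ↦ by positivity)
    (by unfold heatKernel; fun_prop)]
  refine ENNReal.toReal_le_of_le_ofReal
    (mul_nonneg (by positivity) (hGnn _ (by positivity))) ?_
  calc _ ≤ ∫⁻ z, ∫⁻ a in Set.uIoc x y, ENNReal.ofReal (k a z) := lintegral_mono hpt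
    _ = ∫⁻ a in Set.uIoc x y, ∫⁻ z, ENNReal.ofReal (k a z) :=
        lintegral_lintegral_swap
          (hkc.comp continuous_swap).measurable.ennreal_ofReal.aemeasurable
    _ ≤ ∫⁻ _ in Set.uIoc x y, ENNReal.ofReal (√2 / √t * G (|x| + |x - y|)) :=
        setLIntegral_mono measurable_const hka
    _ = ENNReal.ofReal (√2 / √t * G (|x| + |x - y|)) * ENNReal.ofReal |x - y| := by
        rw [setLIntegral_const, Set.uIoc, volume_Ioc, max_sub_min_eq_abs']
    _ = _ := by
        rw [← ENNReal.ofReal_mul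
          (mul_nonneg (by positivity) (hGnn _ (by positivity)))]
        congr 1
        simp only [hG]
        ring
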